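/- arXiv:2307.13515 — 4 statements merged into one kernel-verified Lean document; each statement's English description precedes it below -/
import Mathlib

section
/- Let T > 0 and let h : [0,T] × ℝ → ℝ be an L¹-Carathéodory function such that h(t,s) > 0 for a.e. t ∈ [0,T] and all s < 0. Then every solution u of u'' + h(t,u) = 0 on (0,T) with boundary conditions u'(T) = u(0) and u'(0) = u(0) satisfies u(t) ≥ 0 for all t ∈ [0,T]. -/
open MeasureTheory Set Filter

noncomputable section

/-- Lebesgue measure restricted to `[0,T]`. -/
def muT (T : ℝ) : Measure ℝ := volume.restrict (Icc 0 T)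

/-- `u` is a solution of `u'' + h(t,u) = 0` on `[0,T]`: `u` is `C¹` on `[0,T]` with
derivative `u'`, and `u'` is absolutely continuous with a.e. second derivative
`-h(t,u(t))`, expressed in integral form. -/
def IsSolutionODE1 (T : ℝ) (h : ℝ → ℝ → ℝ) (u u' : ℝ → ℝ) : Prop :=
  (∀ t ∈ Icc (0:ℝ) T, HasDerivWithinAt u (u' t) (Icc (0:ℝ) T) t) ∧
  IntegrableOn (fun s => h s (u s)) (Icc (0:ℝ) T) ∧
  (∀ t ∈ Icc (0:ℝ) T, u' t = u' 0 - ∫ s in (0:ℝ)..t, h s (u s))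

/-- `h` is an `L¹`-Carathéodory function on `[0,T] × ℝ`. -/
def IsL1Caratheodory2 (T : ℝ) (h : ℝ → ℝ → ℝ) : Prop :=
  (∀ s : ℝ, Measurable fun t => h t s) ∧
  (∀ᵐ t ∂(muT T), Continuous fun s => h t s) ∧
  (∀ R : ℝ, 0 < R → ∃ η : ℝ → ℝ, IntegrableOn η (Icc (0:ℝ) T) ∧
    ∀ᵐ t ∂(muT T), ∀ s : ℝ, |s| ≤ R → |h t s| ≤ η t)

/-- Mean value theorem for a solution on a subinterval of `[0,T]`. -/
theorem IsSolutionODE1.exists_sub_eq_mul {T : ℝ} {h : ℝ → ℝ → ℝ} {u u' : ℝ → ℝ}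
    (hsol : IsSolutionODE1 T h u u') {a b : ℝ} (ha : 0 ≤ a) (hab : a < b) (hb : b ≤ T) :
    ∃ c ∈ Ioo a b, u b - u a = u' c * (b - a) := by
  have hcont : ContinuousOn u (Icc a b) := fun x hx =>
    (hsol.1 x ⟨ha.trans hx.1, hx.2.trans hb⟩).continuousWithinAt.mono (Icc_subset_Icc ha hb)
  obtain ⟨c, hc, hslope⟩ := exists_hasDerivAt_eq_slope u u' hab hcont fun x hx =>
    (hsol.1 x ⟨ha.trans hx.1.le, hx.2.le.trans hb⟩).hasDerivAt
      (Icc_mem_nhds (ha.trans_lt hx.1) (hx.2.trans_le hb))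
  refine ⟨c, hc, ?_⟩
  rw [hslope, div_mul_cancel₀ _ (sub_pos.2 hab).ne']

/-- The derivative of a solution strictly decreases across an interval where the solution is
negative. -/
theorem IsSolutionODE1.deriv_lt_of_neg {T : ℝ} {h : ℝ → ℝ → ℝ} {u u' : ℝ → ℝ}
    (hsol : IsSolutionODE1 T h u u') (hpos : ∀ᵐ t ∂(muT T), ∀ s : ℝ, s < 0 → 0 < h t s)
    {a b : ℝ} (ha : 0 ≤ a) (hab : a < b) (hb : b ≤ T) (hneg : ∀ t ∈ Ioo a b, u t < 0) :
    u' b < u' a := by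
  obtain ⟨-, hint, heq⟩ := hsol
  have hii : ∀ {x y : ℝ}, 0 ≤ x → x ≤ y → y ≤ T →
      IntervalIntegrable (fun s => h s (u s)) volume x y := fun hx hxy hy =>
    (intervalIntegrable_iff_integrableOn_Icc_of_le hxy).2 (hint.mono_set (Icc_subset_Icc hx hy))
  have hadd := intervalIntegral.integral_add_adjacent_intervals
    (hii le_rfl ha (hab.le.trans hb)) (hii ha hab.le hb)
  have hae : ∀ᵐ t ∂(volume.restrict (Ioo a b)), 0 < h t (u t) := by
    have hsub : Ioo a b ⊆ Icc 0 T := fun t ht => ⟨ha.trans ht.1.le, ht.2.le.trans hb⟩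
    filter_upwards [ae_restrict_of_ae_restrict_of_subset hsub hpos,
      ae_restrict_mem measurableSet_Ioo] with t ht htm using ht _ (hneg t htm)
  have hIoc : ∀ᵐ t ∂(volume.restrict (Ioc a b)), 0 < h t (u t) := by
    rwa [← Measure.restrict_congr_set Ioo_ae_eq_Ioc]
  have hI : 0 < ∫ s in a..b, h s (u s) := by
    have := intervalIntegral.integral_lt_integral_of_ae_le_of_measure_setOfPred_lt_ne_zero
      (f := fun _ => (0 : ℝ)) hab.le intervalIntegrable_const (hii ha hab.le hb)
      (hIoc.mono fun t ht => ht.le) ?_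
    · simpa using this
    · intro h0
      have hfalse : ∀ᵐ t ∂(volume.restrict (Ioc a b)), False := by
        filter_upwards [hIoc, measure_eq_zero_iff_ae_notMem.1 h0] with t ht hn using hn ht
      rw [eventually_false_iff_eq_bot, ae_eq_bot, Measure.restrict_eq_zero, Real.volume_Ioc,
        ENNReal.ofReal_eq_zero] at hfalse
      linarith
  rw [heq a ⟨ha, hab.le.trans hb⟩, heq b ⟨ha.trans hab.le, hb⟩]
  linarith

/-- **Maximum principle (i), boundary conditions `u'(T) = u(0)`, `u'(0) = u(0)`.** -/
theorem max_principle_nonneg_first_bc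
    (T : ℝ) (hT : 0 < T) (h : ℝ → ℝ → ℝ)
    (hCar : IsL1Caratheodory2 T h)
    (hpos : ∀ᵐ t ∂(muT T), ∀ s : ℝ, s < 0 → 0 < h t s)
    (u u' : ℝ → ℝ) (hsol : IsSolutionODE1 T h u u')
    (hbc1 : u' T = u 0) (hbc2 : u' 0 = u 0) :
    ∀ t ∈ Icc (0:ℝ) T, 0 ≤ u t := by
  have hcont : ContinuousOn u (Icc 0 T) := fun x hx => (hsol.1 x hx).continuousWithinAt
  have h0 : 0 ≤ u 0 := by
    by_contra! hc
    have hneg : ∀ t ∈ Icc 0 T, u t < 0 := by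
      by_contra! hex
      have hcpt : IsCompact (Icc 0 T ∩ u ⁻¹' Ici 0) :=
        isCompact_Icc.of_isClosed_subset
          (hcont.preimage_isClosed_of_isClosed isClosed_Icc isClosed_Ici)
          inter_subset_left
      obtain ⟨t₁, ⟨ht₁, hut₁⟩, hleast⟩ := hcpt.exists_isLeast hex
      have hut₁' : 0 ≤ u t₁ := hut₁
      have hneg₁ : ∀ t, 0 ≤ t → t < t₁ → u t < 0 := fun t ht htt => by
        by_contra! hu
        exact (hleast ⟨⟨ht, htt.le.trans ht₁.2⟩, hu⟩).not_gt htt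
      have ht₁pos : 0 < t₁ := ht₁.1.lt_of_ne fun he => by
        rw [← he] at hut₁'
        linarith
      obtain ⟨s, hs, hmvt⟩ := hsol.exists_sub_eq_mul le_rfl ht₁pos ht₁.2
      have hlt := hsol.deriv_lt_of_neg hpos le_rfl hs.1 (hs.2.le.trans ht₁.2)
        fun t ht => hneg₁ t ht.1.le (ht.2.trans hs.2)
      nlinarith
    have hlt := hsol.deriv_lt_of_neg hpos le_rfl hT le_rfl fun t ht => hneg t (Ioo_subset_Icc_self ht)
    linarith
  obtain ⟨t₀, ht₀, hmin⟩ := isCompact_Icc.exists_isMinOn (nonempty_Icc.2 hT.le) hcont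
  suffices hu : 0 ≤ u t₀ from fun t ht => hu.trans (hmin ht)
  by_contra! hu
  have ht₀pos : 0 < t₀ := ht₀.1.lt_of_ne fun he => by
    rw [← he] at hu
    linarith
  have hderiv : 0 ≤ u' t₀ := by
    rcases ht₀.2.eq_or_lt with rfl | hlt
    · linarith
    · have hnhds := Icc_mem_nhds ht₀pos hlt
      exact ((hmin.isLocalMin hnhds).hasDerivAt_eq_zero ((hsol.1 t₀ ht₀).hasDerivAt hnhds)).ge
  obtain ⟨a, ha, hneg⟩ : ∃ a ∈ Ico 0 t₀, ∀ t ∈ Ioo a t₀, u t < 0 := by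
    have hev : ∀ᶠ t in nhdsWithin t₀ (Iio t₀), u t < 0 :=
      (((hcont t₀ ht₀).mono (Icc_subset_Icc_right ht₀.2)).eventually_lt_const hu).filter_mono
        (nhdsWithin_le_of_mem (Icc_mem_nhdsLT ht₀pos))
    exact (mem_nhdsLT_iff_exists_mem_Ico_Ioo_subset ht₀pos).1 hev
  obtain ⟨s, hs, hmvt⟩ := hsol.exists_sub_eq_mul ha.1 ha.2 ht₀.2
  have hlt := hsol.deriv_lt_of_neg hpos (ha.1.trans hs.1.le) hs.2 ht₀.2
    fun t ht => hneg t ⟨hs.1.trans ht.1, ht.2⟩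
  have hle : u t₀ ≤ u a := hmin ⟨ha.1, ha.2.le.trans ht₀.2⟩
  have hprod := mul_pos (hderiv.trans_lt hlt) (sub_pos.2 ha.2)
  linarith
end
end

section
/- Let T > 0 and let h : [0,T] × ℝ → ℝ be an L¹-Carathéodory function with h(t,0) = 0 for a.e. t ∈ [0,T], and suppose there exists q ∈ L¹([0,T],[0,∞)) such that limsup_{s→0⁺} |h(t,s)|/s ≤ q(t) uniformly for a.e. t ∈ [0,T], i.e. for every ε > 0 there exists δ > 0 such that |h(t,s)| ≤ (q(t)+ε)s for a.e. t ∈ [0,T] and all s ∈ (0,δ). Then every solution u of u'' + h(t,u) = 0 on (0,T) with boundary conditions u'(T) = u(0) and u'(0) = u(0), satisfying u(t) ≥ 0 for all t ∈ [0,T] and u not identically zero, satisfies u(t) > 0 for every t ∈ [0,T]. -/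
open MeasureTheory Set Filter

noncomputable section

/-- Increments of `u'` are integrals of the nonlinearity along the solution. -/
lemma IsSolutionODE1.deriv_sub_eq {T : ℝ} {h : ℝ → ℝ → ℝ} {u u' : ℝ → ℝ}
    (hsol : IsSolutionODE1 T h u u') {a t : ℝ} (ha : a ∈ Icc 0 T) (ht : t ∈ Icc 0 T) :
    u' t - u' a = -∫ s in a..t, h s (u s) := by
  obtain ⟨-, hint, heq⟩ := hsol
  have hii : ∀ b ∈ Icc (0:ℝ) T, IntervalIntegrable (fun s => h s (u s)) volume 0 b := by
    intro b hb
    rw [intervalIntegrable_iff_integrableOn_Icc_of_le hb.1]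
    exact hint.mono_set (Icc_subset_Icc le_rfl hb.2)
  rw [heq t ht, heq a ha, ← intervalIntegral.integral_interval_sub_left (hii t ht) (hii a ha)]
  ring

/-- A zero of a nonnegative solution at which the derivative also vanishes is interior, relative
to `[0,T]`, to the zero set of the solution. -/
lemma IsSolutionODE1.eventually_eq_zero {T : ℝ} {h : ℝ → ℝ → ℝ} {q u u' : ℝ → ℝ}
    (hsol : IsSolutionODE1 T h u u') (hzero : ∀ᵐ t ∂(muT T), h t 0 = 0)
    (hq0 : ∀ t, 0 ≤ q t) (hqInt : IntegrableOn q (Icc (0:ℝ) T))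
    {δ : ℝ} (hδ : 0 < δ)
    (hbound : ∀ᵐ t ∂(muT T), ∀ s : ℝ, 0 < s → s < δ → |h t s| ≤ (q t + 1) * s)
    (hnonneg : ∀ t ∈ Icc (0:ℝ) T, 0 ≤ u t)
    {a : ℝ} (ha : a ∈ Icc 0 T) (hua : u a = 0) (hua' : u' a = 0) :
    ∀ᶠ t in nhdsWithin a (Icc 0 T), u t = 0 := by
  have hcont : ContinuousOn u (Icc 0 T) := fun t ht => (hsol.1 t ht).continuousWithinAt
  have hgi : IntegrableOn (fun t => q t + 1) (Icc 0 T) :=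
    Integrable.add hqInt (integrableOn_const (by simp))
  set K : ℝ := ∫ t in Icc 0 T, (q t + 1) with hK
  have hK0 : 0 ≤ K := integral_nonneg fun t => by have := hq0 t; positivity
  obtain ⟨r₀, hr₀, hsmall⟩ : ∃ r₀ > 0, ∀ t ∈ Icc (0:ℝ) T, |t - a| < r₀ → u t < δ := by
    obtain ⟨r₀, hr₀, H⟩ := Metric.continuousWithinAt_iff.1 (hcont a ha) δ hδ
    refine ⟨r₀, hr₀, fun t ht hta => ?_⟩
    have := H ht (by rwa [Real.dist_eq])
    rw [hua, Real.dist_eq, sub_zero] at this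
    exact (le_abs_self _).trans_lt this
  obtain ⟨r, hr, hrr₀, hrK⟩ : ∃ r > 0, r < r₀ ∧ K * r < 1 := by
    refine ⟨min (r₀ / 2) (1 / (K + 1) / 2), by positivity,
      (min_le_left _ _).trans_lt (by linarith), ?_⟩
    have h1 : K * min (r₀ / 2) (1 / (K + 1) / 2) ≤ K * (1 / (K + 1) / 2) :=
      mul_le_mul_of_nonneg_left (min_le_right _ _) hK0
    have h2 : K * (1 / (K + 1) / 2) < 1 := by
      rw [div_div, mul_one_div, div_lt_one (by positivity)]
      linarith
    exact h1.trans_lt h2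
  set I : Set ℝ := Icc 0 T ∩ Icc (a - r) (a + r) with hI
  have hIT : I ⊆ Icc 0 T := inter_subset_left
  have haI : a ∈ I := ⟨ha, by constructor <;> linarith⟩
  have hIconv : Convex ℝ I := (convex_Icc _ _).inter (convex_Icc _ _)
  have hdist : ∀ t ∈ I, |t - a| ≤ r := fun t ht =>
    abs_le.2 ⟨by linarith [ht.2.1], by linarith [ht.2.2]⟩
  obtain ⟨m, hm, hmax⟩ := (isCompact_Icc.inter isCompact_Icc : IsCompact I).exists_isMaxOn
    ⟨a, haI⟩ (hcont.mono hIT)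
  have hM0 : 0 ≤ u m := hnonneg m (hIT hm)
  have hae : ∀ᵐ s ∂(volume : Measure ℝ), s ∈ I → ‖h s (u s)‖ ≤ (q s + 1) * u m := by
    filter_upwards [(ae_restrict_iff' measurableSet_Icc).1 hzero,
      (ae_restrict_iff' measurableSet_Icc).1 hbound] with s hs0 hsb hsI
    have hsT := hIT hsI
    have hqs := hq0 s
    rcases (hnonneg s hsT).eq_or_lt with h0 | hpos
    · rw [← h0, hs0 hsT, norm_zero]
      positivity
    · refine (hsb hsT (u s) hpos (hsmall s hsT ((hdist s hsI).trans_lt hrr₀))).trans ?_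
      exact mul_le_mul_of_nonneg_left (hmax hsI) (by positivity)
  have hderiv : ∀ t ∈ I, ‖u' t‖ ≤ K * u m := by
    intro t ht
    have hsub : uIoc a t ⊆ I := uIoc_subset_uIcc.trans (hIconv.ordConnected.uIcc_subset haI ht)
    have heq := hsol.deriv_sub_eq ha (hIT ht)
    rw [hua', sub_zero] at heq
    rw [heq, norm_neg, intervalIntegral.norm_integral_eq_norm_integral_uIoc]
    have hgi' : IntegrableOn (fun s => (q s + 1) * u m) (Icc 0 T) := hgi.mul_const _
    calc ‖∫ s in uIoc a t, h s (u s)‖ ≤ ∫ s in uIoc a t, (q s + 1) * u m := by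
          refine norm_integral_le_of_norm_le (hgi'.mono_set (hsub.trans hIT)) ?_
          rw [ae_restrict_iff' measurableSet_uIoc]
          filter_upwards [hae] with s hs hst using hs (hsub hst)
      _ ≤ ∫ s in Icc 0 T, (q s + 1) * u m := by
          refine setIntegral_mono_set hgi' (ae_of_all _ fun s => ?_) (hsub.trans hIT).eventuallyLE
          have hqs := hq0 s
          change 0 ≤ (q s + 1) * u m
          positivity
      _ = K * u m := integral_mul_const _ _
  have hum : u m = 0 := by
    have hmv := hIconv.norm_image_sub_le_of_norm_hasDerivWithin_le
      (fun t ht => (hsol.1 t (hIT ht)).mono hIT) hderiv haI hm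
    rw [hua, sub_zero, Real.norm_eq_abs, Real.norm_eq_abs, abs_of_nonneg hM0] at hmv
    have h1 : K * u m * |m - a| ≤ K * u m * r :=
      mul_le_mul_of_nonneg_left (hdist m hm) (by positivity)
    nlinarith
  have hnear : Icc (a - r) (a + r) ∈ nhds a := Icc_mem_nhds (by linarith) (by linarith)
  filter_upwards [self_mem_nhdsWithin, mem_nhdsWithin_of_mem_nhds hnear] with t ht htr
  exact le_antisymm (hum ▸ hmax (⟨ht, htr⟩ : t ∈ I)) (hnonneg t ht)

/-- Under the boundary conditions `u'(T) = u(0) = u'(0)`, the derivative of a nonnegative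
function on `[0,T]` vanishes at each of its zeros. -/
lemma deriv_eq_zero_of_nonneg_of_eq_zero {T : ℝ} (hT : 0 < T) {u u' : ℝ → ℝ}
    (hd : ∀ t ∈ Icc (0:ℝ) T, HasDerivWithinAt u (u' t) (Icc (0:ℝ) T) t)
    (hbc1 : u' T = u 0) (hbc2 : u' 0 = u 0) (hnonneg : ∀ t ∈ Icc (0:ℝ) T, 0 ≤ u t)
    {a : ℝ} (ha : a ∈ Icc 0 T) (hua : u a = 0) : u' a = 0 := by
  have hmin : IsMinOn u (Icc 0 T) a := fun t ht => by
    change u a ≤ u t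
    exact hua ▸ hnonneg t ht
  rcases ha.1.eq_or_lt with rfl | h0
  · rw [hbc2, hua]
  rcases ha.2.eq_or_lt with rfl | h1
  · have hpos : 0 ≤ u' a := hbc1 ▸ hnonneg 0 ⟨le_rfl, hT.le⟩
    have hneg := hmin.localize.hasFDerivWithinAt_nonneg (hd a ha).hasFDerivWithinAt
      (y := 0 - a) (sub_mem_posTangentConeAt_of_segment_subset
        ((convex_Icc 0 a).segment_subset ha ⟨le_rfl, hT.le⟩))
    simp at hneg
    nlinarith
  · have hnhds : Icc 0 T ∈ nhds a := Icc_mem_nhds h0 h1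
    exact (hmin.isLocalMin hnhds).hasDerivAt_eq_zero ((hd a ha).hasDerivAt hnhds)

/-- **Maximum principle (ii), boundary conditions `u'(T) = u(0)`, `u'(0) = u(0)`.** -/
theorem max_principle_pos_first_bc
    (T : ℝ) (hT : 0 < T) (h : ℝ → ℝ → ℝ)
    (hCar : IsL1Caratheodory2 T h)
    (hzero : ∀ᵐ t ∂(muT T), h t 0 = 0)
    (q : ℝ → ℝ) (hq0 : ∀ t, 0 ≤ q t) (hqInt : IntegrableOn q (Icc (0:ℝ) T))
    (hlimsup : ∀ ε : ℝ, 0 < ε → ∃ δ : ℝ, 0 < δ ∧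
      ∀ᵐ t ∂(muT T), ∀ s : ℝ, 0 < s → s < δ → |h t s| ≤ (q t + ε) * s)
    (u u' : ℝ → ℝ) (hsol : IsSolutionODE1 T h u u')
    (hbc1 : u' T = u 0) (hbc2 : u' 0 = u 0)
    (hnonneg : ∀ t ∈ Icc (0:ℝ) T, 0 ≤ u t)
    (hnotzero : ¬ ∀ t ∈ Icc (0:ℝ) T, u t = 0) :
    ∀ t ∈ Icc (0:ℝ) T, 0 < u t := by
  intro t₀ ht₀
  refine (hnonneg t₀ ht₀).lt_of_ne fun hzero₀ => hnotzero ?_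
  obtain ⟨δ, hδ, hbound⟩ := hlimsup 1 one_pos
  have : PreconnectedSpace (Icc (0:ℝ) T) := isPreconnected_iff_preconnectedSpace.1 isPreconnected_Icc
  have hcont : ContinuousOn u (Icc 0 T) := fun t ht => (hsol.1 t ht).continuousWithinAt
  have hclopen : IsClopen {x : Icc (0:ℝ) T | u x = 0} := by
    refine ⟨isClosed_eq (continuousOn_iff_continuous_domRestrict.1 hcont) continuous_const,
      isOpen_iff_mem_nhds.2 fun x hx => ?_⟩
    have hev := hsol.eventually_eq_zero hzero hq0 hqInt hδ hbound hnonneg x.2 hx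
      (deriv_eq_zero_of_nonneg_of_eq_zero hT hsol.1 hbc1 hbc2 hnonneg x.2 hx)
    rw [nhdsWithin_eq_map_subtype_coe x.2] at hev
    exact hev
  intro t ht
  have huniv := hclopen.eq_univ ⟨⟨t₀, ht₀⟩, hzero₀.symm⟩
  exact huniv.ge (mem_univ (⟨t, ht⟩ : Icc (0:ℝ) T))
end
end

section
/- Let T > 0 and let h : [0,T] × ℝ → ℝ be an L¹-Carathéodory function with h(t,0) = 0 for a.e. t ∈ [0,T], and suppose there exists q ∈ L¹([0,T],[0,∞)) such that limsup_{s→0⁺} |h(t,s)|/s ≤ q(t) uniformly for a.e. t ∈ [0,T], i.e. for every ε > 0 there exists δ > 0 such that |h(t,s)| ≤ (q(t)+ε)s for a.e. t ∈ [0,T] and all s ∈ (0,δ). Then every solution u of u'' + h(t,u) = 0 on (0,T) with boundary conditions u(T) = u(0) and u'(0) = 0, satisfying u(t) ≥ 0 for all t ∈ [0,T] and u not identically zero, satisfies u(t) > 0 for every t ∈ [0,T]. -/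
open MeasureTheory Set Filter

noncomputable section

/-- Local uniqueness at a common zero of `u` and its derivative. -/
theorem exists_forall_eq_zero_of_eq_zero {a b δ t₀ : ℝ} {p f u u' : ℝ → ℝ}
    (hp : IntegrableOn p (Icc a b)) (hf : IntegrableOn f (Icc a b)) (hδ : 0 < δ)
    (hbound : ∀ᵐ t ∂(volume.restrict (Icc a b)), u t < δ → |f t| ≤ p t * u t)
    (hp0 : ∀ t, 0 ≤ p t)
    (hu : ∀ t ∈ Icc a b, HasDerivWithinAt u (u' t) (Icc a b) t)
    (hu' : ∀ t ∈ Icc a b, u' t = u' a - ∫ s in a..t, f s)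
    (hnonneg : ∀ t ∈ Icc a b, 0 ≤ u t)
    (ht₀ : t₀ ∈ Icc a b) (hut₀ : u t₀ = 0) (hut₀' : u' t₀ = 0) :
    ∃ r > 0, ∀ t ∈ Icc a b, dist t t₀ < r → u t = 0 ∧ u' t = 0 := by
  have hab : a ≤ b := ht₀.1.trans ht₀.2
  have hII : ∀ {g : ℝ → ℝ}, IntegrableOn g (Icc a b) → ∀ {x y : ℝ}, x ∈ Icc a b → y ∈ Icc a b →
      IntervalIntegrable g volume x y := fun hg x y hx hy =>
    (hg.mono_set ((convex_Icc a b).ordConnected.uIcc_subset hx hy)).intervalIntegrable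
  have ha : a ∈ Icc a b := left_mem_Icc.2 hab
  have hucont : ContinuousOn u (Icc a b) := fun t ht => (hu t ht).continuousWithinAt
  have hFcont : ContinuousOn (fun t => ∫ s in a..t, p s) (Icc a b) := by
    have := intervalIntegral.continuousOn_primitive_interval (a := a) (b := b) (f := p)
      (μ := volume) (by rwa [uIcc_of_le hab])
    rwa [uIcc_of_le hab] at this
  obtain ⟨r₁, hr₁, hsmall⟩ := Metric.continuousOn_iff.1 hucont t₀ ht₀ δ hδ
  obtain ⟨r₂, hr₂, hint⟩ := Metric.continuousOn_iff.1 hFcont t₀ ht₀ (1 / 2) (by norm_num)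
  set r := min 1 (min r₁ r₂ / 2)
  have hr0 : 0 < r := by positivity
  have hr1 : r ≤ 1 := min_le_left _ _
  have hrr : r ≤ min r₁ r₂ / 2 := min_le_right _ _
  have hmin : 0 < min r₁ r₂ := lt_min hr₁ hr₂
  have hrr₁ : r < r₁ := by linarith [min_le_left r₁ r₂]
  have hrr₂ : r < r₂ := by linarith [min_le_right r₁ r₂]
  set S := Icc a b ∩ Metric.closedBall t₀ r
  have hSconv : Convex ℝ S := (convex_Icc a b).inter (convex_closedBall t₀ r)
  have htS : t₀ ∈ S := ⟨ht₀, Metric.mem_closedBall_self hr0.le⟩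
  obtain ⟨x, hxS, hxmax⟩ := (isCompact_Icc.inter_right Metric.isClosed_closedBall).exists_isMaxOn
    ⟨t₀, htS⟩ (hucont.mono inter_subset_left : ContinuousOn u S)
  have hM0 : 0 ≤ u x := hnonneg x hxS.1
  have hderiv : ∀ t ∈ S, |u' t| ≤ u x / 2 := by
    intro t ht
    have hbd : ∀ᵐ s ∂volume.restrict (uIoc t₀ t), ‖f s‖ ≤ p s * u x := by
      have hsub : uIoc t₀ t ⊆ S :=
        uIoc_subset_uIcc.trans (hSconv.ordConnected.uIcc_subset htS ht)
      filter_upwards [ae_restrict_of_ae_restrict_of_subset (hsub.trans inter_subset_left) hbound,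
        ae_restrict_mem measurableSet_uIoc] with s hs hsmem
      have hsS := hsub hsmem
      have hlt : u s < δ := by
        have := hsmall s hsS.1 ((Metric.mem_closedBall.1 hsS.2).trans_lt hrr₁)
        rw [hut₀, Real.dist_eq, sub_zero] at this
        exact (le_abs_self _).trans_lt this
      exact (hs hlt).trans (mul_le_mul_of_nonneg_left (hxmax hsS) (hp0 s))
    have h1 : u' t = -∫ s in t₀..t, f s := by
      have e := intervalIntegral.integral_interval_sub_left (hII hf ha ht.1) (hII hf ha ht₀)
      linarith [hu' t ht.1, hu' t₀ ht₀]
    have h2 : |∫ s in t₀..t, p s| ≤ 1 / 2 := by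
      have := hint t ht.1 ((Metric.mem_closedBall.1 ht.2).trans_lt hrr₂)
      rw [Real.dist_eq, intervalIntegral.integral_interval_sub_left
        (hII hp ha ht.1) (hII hp ha ht₀)] at this
      exact this.le
    calc |u' t| = ‖∫ s in t₀..t, f s‖ := by rw [h1, abs_neg, Real.norm_eq_abs]
      _ ≤ |∫ s in t₀..t, p s * u x| := intervalIntegral.norm_integral_le_abs_of_norm_le hbd
          ((hII hp ht₀ ht.1).mul_const _)
      _ = |∫ s in t₀..t, p s| * u x := by
          rw [intervalIntegral.integral_mul_const, abs_mul, abs_of_nonneg hM0]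
      _ ≤ u x / 2 := by nlinarith
  have hx0 : u x = 0 := by
    have h := hSconv.norm_image_sub_le_of_norm_hasDerivWithin_le
      (fun t ht => (hu t ht.1).mono inter_subset_left) hderiv htS hxS
    rw [hut₀, sub_zero, Real.norm_eq_abs, abs_of_nonneg hM0, ← dist_eq_norm] at h
    have := Metric.mem_closedBall.1 hxS.2
    nlinarith
  refine ⟨r, hr0, fun t ht htr => ?_⟩
  have htS' : t ∈ S := ⟨ht, htr.le⟩
  refine ⟨le_antisymm (hx0 ▸ hxmax htS') (hnonneg t ht), ?_⟩
  have := hderiv t htS'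
  rw [hx0, zero_div] at this
  exact abs_nonpos_iff.1 this

/-- Global uniqueness: if `u` and `u'` vanish at one point, then `u` vanishes identically. -/
theorem eq_zero_of_eq_zero_of_deriv_eq_zero {a b δ t₀ : ℝ} {p f u u' : ℝ → ℝ}
    (hp : IntegrableOn p (Icc a b)) (hf : IntegrableOn f (Icc a b)) (hδ : 0 < δ)
    (hbound : ∀ᵐ t ∂(volume.restrict (Icc a b)), u t < δ → |f t| ≤ p t * u t)
    (hp0 : ∀ t, 0 ≤ p t)
    (hu : ∀ t ∈ Icc a b, HasDerivWithinAt u (u' t) (Icc a b) t)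
    (hu' : ∀ t ∈ Icc a b, u' t = u' a - ∫ s in a..t, f s)
    (hnonneg : ∀ t ∈ Icc a b, 0 ≤ u t)
    (ht₀ : t₀ ∈ Icc a b) (hut₀ : u t₀ = 0) (hut₀' : u' t₀ = 0) :
    ∀ t ∈ Icc a b, u t = 0 := by
  have hab : a ≤ b := ht₀.1.trans ht₀.2
  have hucont : ContinuousOn u (Icc a b) := fun t ht => (hu t ht).continuousWithinAt
  have hucont' : ContinuousOn u' (Icc a b) := by
    have := intervalIntegral.continuousOn_primitive_interval (a := a) (b := b) (f := f)
      (μ := volume) (by rwa [uIcc_of_le hab])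
    rw [uIcc_of_le hab] at this
    exact (continuousOn_const.sub this).congr hu'
  let Z : Set (Icc a b) := {t | u t = 0 ∧ u' t = 0}
  have hclosed : IsClosed Z :=
    (isClosed_eq hucont.domRestrict continuous_const).inter
      (isClosed_eq hucont'.domRestrict continuous_const)
  have hopen : IsOpen Z := Metric.isOpen_iff.2 fun t ht => by
    obtain ⟨r, hr, h⟩ := exists_forall_eq_zero_of_eq_zero hp hf hδ hbound hp0 hu hu' hnonneg
      t.2 ht.1 ht.2
    exact ⟨r, hr, fun s hs => h s s.2 hs⟩
  have : PreconnectedSpace (Icc a b) := Subtype.preconnectedSpace isPreconnected_Icc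
  have hZ : Z = univ := IsClopen.eq_univ ⟨hclosed, hopen⟩ ⟨⟨t₀, ht₀⟩, hut₀, hut₀'⟩
  intro t ht
  exact (hZ ▸ mem_univ (⟨t, ht⟩ : Icc a b) : (⟨t, ht⟩ : Icc a b) ∈ Z).1

/-- **Maximum principle (ii), boundary conditions `u(T) = u(0)`, `u'(0) = 0`.** -/
theorem max_principle_pos_second_bc
    (T : ℝ) (hT : 0 < T) (h : ℝ → ℝ → ℝ)
    (hCar : IsL1Caratheodory2 T h)
    (hzero : ∀ᵐ t ∂(muT T), h t 0 = 0)
    (q : ℝ → ℝ) (hq0 : ∀ t, 0 ≤ q t) (hqInt : IntegrableOn q (Icc (0:ℝ) T))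
    (hlimsup : ∀ ε : ℝ, 0 < ε → ∃ δ : ℝ, 0 < δ ∧
      ∀ᵐ t ∂(muT T), ∀ s : ℝ, 0 < s → s < δ → |h t s| ≤ (q t + ε) * s)
    (u u' : ℝ → ℝ) (hsol : IsSolutionODE1 T h u u')
    (hbc1 : u T = u 0) (hbc2 : u' 0 = 0)
    (hnonneg : ∀ t ∈ Icc (0:ℝ) T, 0 ≤ u t)
    (hnotzero : ¬ ∀ t ∈ Icc (0:ℝ) T, u t = 0) :
    ∀ t ∈ Icc (0:ℝ) T, 0 < u t := by
  obtain ⟨hu, hf, hu'⟩ := hsol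
  obtain ⟨δ, hδ, hle⟩ := hlimsup 1 one_pos
  have hbound : ∀ᵐ t ∂(volume.restrict (Icc 0 T)),
      u t < δ → |h t (u t)| ≤ (q t + 1) * u t := by
    filter_upwards [hle, hzero, ae_restrict_mem measurableSet_Icc] with t h1 h2 ht hlt
    rcases (hnonneg t ht).eq_or_lt with h0 | h0
    · simp [← h0, h2]
    · exact h1 _ h0 hlt
  have hunique : ∀ t₀ ∈ Icc 0 T, u t₀ = 0 → u' t₀ ≠ 0 := fun t₀ ht₀ h0 h0' =>
    hnotzero <| eq_zero_of_eq_zero_of_deriv_eq_zero (p := fun t => q t + 1)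
      (hqInt.add (integrableOn_const (by simp))) hf hδ hbound
      (fun t => by linarith [hq0 t]) hu hu' hnonneg ht₀ h0 h0'
  have hu0 : u 0 ≠ 0 := fun h0 => hunique 0 (left_mem_Icc.2 hT.le) h0 hbc2
  intro t ht
  refine (hnonneg t ht).lt_of_ne' fun h0 => ?_
  have ht0 : 0 < t := ht.1.lt_of_ne (by rintro rfl; exact hu0 h0)
  have htT : t < T := ht.2.lt_of_ne (by rintro rfl; exact hu0 (hbc1 ▸ h0))
  have hnhds : Icc 0 T ∈ nhds t := Icc_mem_nhds ht0 htT
  have hmin : IsLocalMin u t := by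
    filter_upwards [hnhds] with s hs
    rw [h0]
    exact hnonneg s hs
  exact hunique t ht h0 (hmin.hasDerivAt_eq_zero ((hu t ht).hasDerivAt hnhds))
end
end

section
/- Let T > 0 and let h : [0,T] × ℝ → ℝ be an L¹-Carathéodory function with h(t,0) = 0 for a.e. t ∈ [0,T]. Suppose there exist δ > 0 and a nonnegative function q₁ ∈ L¹([0,T]) such that |h(t,s)| ≤ q₁(t)·s for a.e. t ∈ [0,T] and all s ∈ [0,δ]. Let u : [0,T] → ℝ be of class C¹ with u' absolutely continuous, satisfying u''(t) + h(t,u(t)) = 0 for a.e. t ∈ [0,T] and u(t) ≥ 0 for all t ∈ [0,T]. If there exists t* ∈ [0,T] with u(t*) = 0 and u'(t*) = 0, then u(t) = 0 for all t ∈ [0,T]. -/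
open MeasureTheory Set Filter

noncomputable section

/-- A nonnegative solution with `u t₀ = u' t₀ = 0` vanishes, with its derivative, near `t₀`. -/
theorem exists_forall_dist_lt_eq_zero
    (T : ℝ) (h : ℝ → ℝ → ℝ) (δ : ℝ) (hδ : 0 < δ) (q₁ : ℝ → ℝ)
    (hq₁Int : IntegrableOn q₁ (Icc (0:ℝ) T))
    (hbound : ∀ᵐ t ∂(muT T), ∀ s : ℝ, 0 ≤ s → s ≤ δ → |h t s| ≤ q₁ t * s)
    (hq₁0 : ∀ t, 0 ≤ q₁ t)
    (u u' : ℝ → ℝ) (hsol : IsSolutionODE1 T h u u')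
    (hnonneg : ∀ t ∈ Icc (0:ℝ) T, 0 ≤ u t)
    (t₀ : ℝ) (ht₀ : t₀ ∈ Icc (0:ℝ) T) (hu₀ : u t₀ = 0) (hu'₀ : u' t₀ = 0) :
    ∃ ε > 0, ∀ t ∈ Icc (0:ℝ) T, dist t t₀ < ε → u t = 0 ∧ u' t = 0 := by
  obtain ⟨hderiv, hint, heq⟩ := hsol
  have hucont : ContinuousOn u (Icc 0 T) := fun t ht => (hderiv t ht).continuousWithinAt
  have hT : (0:ℝ) ≤ T := ht₀.1.trans ht₀.2
  have hii : ∀ {f : ℝ → ℝ}, IntegrableOn f (Icc (0:ℝ) T) → ∀ {a b : ℝ}, a ∈ Icc (0:ℝ) T →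
      b ∈ Icc (0:ℝ) T → IntervalIntegrable f volume a b := fun hf a b ha hb =>
    (hf.mono_set (uIcc_subset_Icc ha hb)).intervalIntegrable
  have h0 : (0:ℝ) ∈ Icc (0:ℝ) T := ⟨le_rfl, hT⟩
  have hQcont : ContinuousOn (fun t => ∫ s in t₀..t, q₁ s) (Icc 0 T) := by
    have hc : ContinuousOn (fun t => ∫ s in (0:ℝ)..t, q₁ s) (Icc 0 T) := by
      have := intervalIntegral.continuousOn_primitive_interval (μ := volume) (f := q₁)
        (a := 0) (b := T) (by rwa [uIcc_of_le hT])
      rwa [uIcc_of_le hT] at this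
    refine (hc.sub (continuousOn_const (c := ∫ s in (0:ℝ)..t₀, q₁ s))).congr fun t ht => ?_
    exact (intervalIntegral.integral_interval_sub_left (hii hq₁Int h0 ht)
      (hii hq₁Int h0 ht₀)).symm
  obtain ⟨ε₁, hε₁, hu_small⟩ := Metric.continuousOn_iff.1 hucont t₀ ht₀ δ hδ
  obtain ⟨ε₂, hε₂, hQ_small⟩ := Metric.continuousOn_iff.1 hQcont t₀ ht₀ (1 / 2) (by norm_num)
  obtain ⟨ε, hε, hεlt⟩ := exists_between (lt_min (lt_min hε₁ hε₂) one_pos)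
  simp only [lt_min_iff] at hεlt
  obtain ⟨⟨hεε₁, hεε₂⟩, hεone⟩ := hεlt
  set J := Icc (0:ℝ) T ∩ Metric.closedBall t₀ ε with hJ
  have hJT : J ⊆ Icc 0 T := inter_subset_left
  have hJcompact : IsCompact J := isCompact_Icc.inter_right Metric.isClosed_closedBall
  have hJconvex : Convex ℝ J := (convex_Icc 0 T).inter (convex_closedBall t₀ ε)
  have ht₀J : t₀ ∈ J := ⟨ht₀, Metric.mem_closedBall_self hε.le⟩
  obtain ⟨m, hmJ, hm⟩ := hJcompact.exists_isMaxOn ⟨t₀, ht₀J⟩ (hucont.mono hJT)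
  have hM : ∀ t ∈ J, u t ≤ u m := fun t ht => hm ht
  have hM0 : 0 ≤ u m := hnonneg m (hJT hmJ)
  have hu' : ∀ t ∈ J, |u' t| ≤ u m / 2 := by
    intro t ht
    have hint_eq : u' t = -∫ s in t₀..t, h s (u s) := by
      have h1 := heq t (hJT ht)
      have h2 := heq t₀ ht₀
      have h3 := intervalIntegral.integral_interval_sub_left (hii hint h0 (hJT ht))
        (hii hint h0 ht₀)
      linarith
    have hsub : uIcc t₀ t ⊆ J := hJconvex.ordConnected.uIcc_subset ht₀J ht
    have hle : ‖∫ s in t₀..t, h s (u s)‖ ≤ |∫ s in t₀..t, q₁ s * u m| := by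
      refine intervalIntegral.norm_integral_le_abs_of_norm_le ?_
        ((hii hq₁Int ht₀ (hJT ht)).mul_const _)
      have hsubT : uIoc t₀ t ⊆ Icc 0 T := uIoc_subset_uIcc.trans (hsub.trans hJT)
      filter_upwards [ae_restrict_of_ae_restrict_of_subset hsubT hbound,
        ae_restrict_mem measurableSet_uIoc] with s hs hst
      have hsJ : s ∈ J := hsub (uIoc_subset_uIcc hst)
      have hsδ := hu_small s (hJT hsJ) ((Metric.mem_closedBall.1 hsJ.2).trans_lt hεε₁)
      rw [hu₀, Real.dist_eq, sub_zero] at hsδ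
      exact (hs (u s) (hnonneg s (hJT hsJ)) ((le_abs_self _).trans hsδ.le)).trans
        (mul_le_mul_of_nonneg_left (hM s hsJ) (hq₁0 s))
    have hQt := hQ_small t (hJT ht) ((Metric.mem_closedBall.1 ht.2).trans_lt hεε₂)
    rw [intervalIntegral.integral_same, Real.dist_eq, sub_zero] at hQt
    rw [intervalIntegral.integral_mul_const, abs_mul, abs_of_nonneg hM0, Real.norm_eq_abs] at hle
    rw [hint_eq, abs_neg]
    nlinarith
  have hmz : u m = 0 := by
    have hmv := hJconvex.norm_image_sub_le_of_norm_hasDerivWithin_le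
      (fun t ht => (hderiv t (hJT ht)).mono hJT) hu' ht₀J hmJ
    have hdist : ‖m - t₀‖ ≤ 1 := (Metric.mem_closedBall.1 hmJ.2).trans hεone.le
    rw [hu₀, sub_zero, Real.norm_of_nonneg hM0] at hmv
    nlinarith
  refine ⟨ε, hε, fun t ht htε => ?_⟩
  have htJ : t ∈ J := ⟨ht, htε.le⟩
  refine ⟨le_antisymm (hmz ▸ hM t htJ) (hnonneg t ht), ?_⟩
  have := hu' t htJ
  rw [hmz, zero_div] at this
  exact abs_nonpos_iff.1 this

/-- **Vanishing at a point with vanishing derivative forces the trivial solution.** -/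
theorem vanishing_point_implies_trivial
    (T : ℝ) (hT : 0 < T) (h : ℝ → ℝ → ℝ)
    (hCar : IsL1Caratheodory2 T h)
    (hzero : ∀ᵐ t ∂(muT T), h t 0 = 0)
    (δ : ℝ) (hδ : 0 < δ) (q₁ : ℝ → ℝ) (hq₁0 : ∀ t, 0 ≤ q₁ t)
    (hq₁Int : IntegrableOn q₁ (Icc (0:ℝ) T))
    (hbound : ∀ᵐ t ∂(muT T), ∀ s : ℝ, 0 ≤ s → s ≤ δ → |h t s| ≤ q₁ t * s)
    (u u' : ℝ → ℝ) (hsol : IsSolutionODE1 T h u u')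
    (hnonneg : ∀ t ∈ Icc (0:ℝ) T, 0 ≤ u t)
    (hstar : ∃ tstar ∈ Icc (0:ℝ) T, u tstar = 0 ∧ u' tstar = 0) :
    ∀ t ∈ Icc (0:ℝ) T, u t = 0 := by
  obtain ⟨t₀, ht₀, hu₀, hu'₀⟩ := hstar
  have hucont : ContinuousOn u (Icc 0 T) := fun t ht => (hsol.1 t ht).continuousWithinAt
  have hu'cont : ContinuousOn u' (Icc 0 T) := by
    have hc := intervalIntegral.continuousOn_primitive_interval (μ := volume)
      (f := fun s => h s (u s)) (a := 0) (b := T) (by rw [uIcc_of_le hT.le]; exact hsol.2.1)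
    rw [uIcc_of_le hT.le] at hc
    exact (continuousOn_const.sub hc).congr hsol.2.2
  have : PreconnectedSpace (Icc (0:ℝ) T) := Subtype.preconnectedSpace isPreconnected_Icc
  let Z : Set (Icc (0:ℝ) T) := {t | u t = 0 ∧ u' t = 0}
  have hclosed : IsClosed Z :=
    (isClosed_eq hucont.domRestrict continuous_const).inter
      (isClosed_eq hu'cont.domRestrict continuous_const)
  have hopen : IsOpen Z := by
    refine Metric.isOpen_iff.2 fun t ht => ?_
    obtain ⟨ε, hε, hz⟩ := exists_forall_dist_lt_eq_zero T h δ hδ q₁ hq₁Int hbound hq₁0 u u' hsol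
      hnonneg t t.2 ht.1 ht.2
    exact ⟨ε, hε, fun s hs => hz s s.2 hs⟩
  have hZ : Z = univ := IsClopen.eq_univ ⟨hclosed, hopen⟩ ⟨⟨t₀, ht₀⟩, hu₀, hu'₀⟩
  intro t ht
  have htZ : (⟨t, ht⟩ : Icc (0:ℝ) T) ∈ Z := hZ ▸ mem_univ _
  exact htZ.1
end
end
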